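/- Suppose there exist constants C_V, C_U, C_s > 0 such that ‖V^k‖_F² ≤ C_V, ‖U^k‖_F² ≤ C_U and ‖s^k‖₂² ≤ C_s for all k ≥ 0, and suppose ρ ≥ max(24 λ_ex² C_V C_s / λ̲_V, 1/2 + √(1/4 + 6 λ_ex² C_V²)) and 0 < γ ≤ 1/(√m((1+α₀)C_V + λ̄_U) + 1). Then the gradients of the augmented Lagrangian along the iterates converge to zero: ∇_V L_ρ(V^k,U^k,s^k,w^k) → 0, ∇_U L_ρ(V^k,U^k,s^k,w^k) → 0, ∇_s L_ρ(V^k,U^k,s^k,w^k) → 0, and ∇_w L_ρ(V^k,U^k,s^k,w^k) → 0 as k → ∞. -/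

import Mathlib

open Matrix Finset Filter Topology

noncomputable section

/-- Squared Frobenius norm of a real matrix. -/
def frobSq {a b : ℕ} (A : Matrix (Fin a) (Fin b) ℝ) : ℝ := ∑ i, ∑ j, (A i j) ^ 2

/-- Frobenius norm of a real matrix. -/
def frobNorm {a b : ℕ} (A : Matrix (Fin a) (Fin b) ℝ) : ℝ := Real.sqrt (frobSq A)

/-- Frobenius (trace) inner product of matrices. -/
def frobInner {a b : ℕ} (A B : Matrix (Fin a) (Fin b) ℝ) : ℝ := ∑ i, ∑ j, A i j * B i j

/-- Squared Euclidean norm of a vector. -/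
def vecSq {a : ℕ} (x : Fin a → ℝ) : ℝ := ∑ i, (x i) ^ 2

/-- Euclidean norm of a vector. -/
def vecNorm {a : ℕ} (x : Fin a → ℝ) : ℝ := Real.sqrt (vecSq x)

/-- Entrywise (Hadamard) product of matrices. -/
def hprod {a b : ℕ} (A B : Matrix (Fin a) (Fin b) ℝ) : Matrix (Fin a) (Fin b) ℝ :=
  Matrix.of fun i j => A i j * B i j

/-- The iALS loss L(V,U). -/
def iALSLoss {m n d : ℕ} (R : Matrix (Fin m) (Fin n) ℝ) (α₀ : ℝ)
    (lamU : Fin m → ℝ) (lamV : Fin n → ℝ)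
    (V : Matrix (Fin n) (Fin d) ℝ) (U : Matrix (Fin m) (Fin d) ℝ) : ℝ :=
  (1/2) * frobSq (hprod R (R - U * Vᵀ)) + (α₀/2) * frobSq (U * Vᵀ)
    + (1/2) * ∑ i, lamU i * vecSq (U i) + (1/2) * ∑ j, lamV j * vecSq (V j)

/-- g(V,U,s) = L(V,U) + (λ_ex/2)‖V s‖₂². -/
def gFun {m n d : ℕ} (R : Matrix (Fin m) (Fin n) ℝ) (α₀ lamex : ℝ)
    (lamU : Fin m → ℝ) (lamV : Fin n → ℝ)
    (V : Matrix (Fin n) (Fin d) ℝ) (U : Matrix (Fin m) (Fin d) ℝ) (s : Fin d → ℝ) : ℝ :=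
  iALSLoss R α₀ lamU lamV V U + (lamex/2) * vecSq (V.mulVec s)

/-- (1/m) Uᵀ 𝟙 : the average of the rows of U. -/
def avgRow {m d : ℕ} (U : Matrix (Fin m) (Fin d) ℝ) : Fin d → ℝ :=
  fun k => (1 / (m : ℝ)) * ∑ i, U i k

/-- The augmented Lagrangian L_ρ(V,U,s,w). -/
def augL {m n d : ℕ} (R : Matrix (Fin m) (Fin n) ℝ) (α₀ lamex : ℝ)
    (lamU : Fin m → ℝ) (lamV : Fin n → ℝ) (ρ : ℝ)
    (V : Matrix (Fin n) (Fin d) ℝ) (U : Matrix (Fin m) (Fin d) ℝ) (s w : Fin d → ℝ) : ℝ :=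
  gFun R α₀ lamex lamU lamV V U s + (ρ/2) * vecSq (avgRow U - s + w) - (ρ/2) * vecSq w

/-- Gradient of g with respect to V; the j-th row is
(Σ_i R_{ij} u_i u_iᵀ + α₀ UᵀU + λ_ex s sᵀ + λ_V^{(j)} I) v_j − Σ_i R_{ij} u_i. -/
def gradV {m n d : ℕ} (R : Matrix (Fin m) (Fin n) ℝ) (α₀ lamex : ℝ)
    (lamV : Fin n → ℝ)
    (V : Matrix (Fin n) (Fin d) ℝ) (U : Matrix (Fin m) (Fin d) ℝ) (s : Fin d → ℝ) :
    Matrix (Fin n) (Fin d) ℝ :=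
  Matrix.of fun j =>
    ((∑ i, R i j • vecMulVec (U i) (U i)) + α₀ • (Uᵀ * U)
        + lamex • vecMulVec s s + (lamV j) • (1 : Matrix (Fin d) (Fin d) ℝ)).mulVec (V j)
      - ∑ i, R i j • U i

/-- Gradient of g with respect to U; the i-th row is
(Σ_j R_{ij} v_j v_jᵀ + α₀ VᵀV + λ_U^{(i)} I) u_i − Σ_j R_{ij} v_j (independent of s). -/
def gradU {m n d : ℕ} (R : Matrix (Fin m) (Fin n) ℝ) (α₀ : ℝ)
    (lamU : Fin m → ℝ)
    (V : Matrix (Fin n) (Fin d) ℝ) (U : Matrix (Fin m) (Fin d) ℝ) :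
    Matrix (Fin m) (Fin d) ℝ :=
  Matrix.of fun i =>
    ((∑ j, R i j • vecMulVec (V j) (V j)) + α₀ • (Vᵀ * V)
        + (lamU i) • (1 : Matrix (Fin d) (Fin d) ℝ)).mulVec (U i)
      - ∑ j, R i j • V j

/-- Gradient of g with respect to s: λ_ex VᵀV s (independent of U). -/
def gradS {n d : ℕ} (lamex : ℝ) (V : Matrix (Fin n) (Fin d) ℝ) (s : Fin d → ℝ) : Fin d → ℝ :=
  lamex • (Vᵀ * V).mulVec s

/-- Gradient of the augmented Lagrangian with respect to U. -/
def gradUL {m n d : ℕ} (R : Matrix (Fin m) (Fin n) ℝ) (α₀ : ℝ) (lamU : Fin m → ℝ) (ρ : ℝ)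
    (V : Matrix (Fin n) (Fin d) ℝ) (U : Matrix (Fin m) (Fin d) ℝ) (s w : Fin d → ℝ) :
    Matrix (Fin m) (Fin d) ℝ :=
  Matrix.of fun i => gradU R α₀ lamU V U i + (ρ / (m : ℝ)) • (avgRow U - s + w)

/-- Gradient of the augmented Lagrangian with respect to s:
λ_ex VᵀV s − ρ((1/m)Uᵀ𝟙 − s + w). -/
def gradSL {m n d : ℕ} (lamex ρ : ℝ)
    (V : Matrix (Fin n) (Fin d) ℝ) (U : Matrix (Fin m) (Fin d) ℝ) (s w : Fin d → ℝ) :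
    Fin d → ℝ :=
  gradS lamex V s - ρ • (avgRow U - s + w)

/-- Gradient of the augmented Lagrangian with respect to w: ρ((1/m)Uᵀ𝟙 − s). -/
def gradWL {m d : ℕ} (ρ : ℝ) (U : Matrix (Fin m) (Fin d) ℝ) (s : Fin d → ℝ) : Fin d → ℝ :=
  ρ • (avgRow U - s)

lemma frobSq_nonneg {a b : ℕ} (A : Matrix (Fin a) (Fin b) ℝ) : 0 ≤ frobSq A :=
  Finset.sum_nonneg fun _ _ => Finset.sum_nonneg fun _ _ => sq_nonneg _

lemma vecSq_nonneg {a : ℕ} (x : Fin a → ℝ) : 0 ≤ vecSq x :=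
  Finset.sum_nonneg fun _ _ => sq_nonneg _

lemma frobSq_eq_sum_vecSq {a b : ℕ} (A : Matrix (Fin a) (Fin b) ℝ) :
    frobSq A = ∑ i, vecSq (A i) := rfl

lemma vecSq_eq_dotProduct {a : ℕ} (x : Fin a → ℝ) : vecSq x = x ⬝ᵥ x := by
  simp only [vecSq, dotProduct, sq]

lemma frobInner_eq_sum_dotProduct {a b : ℕ} (A B : Matrix (Fin a) (Fin b) ℝ) :
    frobInner A B = ∑ i, A i ⬝ᵥ B i := rfl

lemma vecSq_add {a : ℕ} (x y : Fin a → ℝ) :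
    vecSq (x + y) = vecSq x + 2 * (y ⬝ᵥ x) + vecSq y := by
  simp only [vecSq_eq_dotProduct, add_dotProduct, dotProduct_add, dotProduct_comm x y]
  ring

lemma vecSq_smul {a : ℕ} (t : ℝ) (x : Fin a → ℝ) : vecSq (t • x) = t ^ 2 * vecSq x := by
  simp only [vecSq_eq_dotProduct, smul_dotProduct, dotProduct_smul, smul_eq_mul]
  ring

lemma frobSq_add {a b : ℕ} (A B : Matrix (Fin a) (Fin b) ℝ) :
    frobSq (A + B) = frobSq A + 2 * frobInner B A + frobSq B := by
  have h : ∀ i, vecSq ((A + B) i) = vecSq (A i) + 2 * (B i ⬝ᵥ A i) + vecSq (B i) :=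
    fun i => vecSq_add (A i) (B i)
  simp only [frobSq_eq_sum_vecSq, frobInner_eq_sum_dotProduct, h, Finset.sum_add_distrib,
    Finset.mul_sum]

lemma frobSq_smul {a b : ℕ} (t : ℝ) (A : Matrix (Fin a) (Fin b) ℝ) :
    frobSq (t • A) = t ^ 2 * frobSq A := by
  simp only [frobSq, Finset.mul_sum, Matrix.smul_apply, smul_eq_mul, mul_pow]

lemma frobSq_neg {a b : ℕ} (A : Matrix (Fin a) (Fin b) ℝ) : frobSq (-A) = frobSq A := by
  simp [frobSq]

lemma vecSq_neg {a : ℕ} (x : Fin a → ℝ) : vecSq (-x) = vecSq x := by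
  simp [vecSq]

lemma frobSq_transpose {a b : ℕ} (A : Matrix (Fin a) (Fin b) ℝ) : frobSq Aᵀ = frobSq A :=
  Finset.sum_comm

lemma frobInner_self {a b : ℕ} (A : Matrix (Fin a) (Fin b) ℝ) : frobInner A A = frobSq A := by
  simp only [frobInner, frobSq, sq]

lemma frobInner_smul_left {a b : ℕ} (t : ℝ) (A B : Matrix (Fin a) (Fin b) ℝ) :
    frobInner (t • A) B = t * frobInner A B := by
  simp only [frobInner, Finset.mul_sum, Matrix.smul_apply, smul_eq_mul, mul_assoc]

lemma frobInner_add_left {a b : ℕ} (A B C : Matrix (Fin a) (Fin b) ℝ) :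
    frobInner (A + B) C = frobInner A C + frobInner B C := by
  simp only [frobInner, ← Finset.sum_add_distrib, Matrix.add_apply, add_mul]

lemma frobInner_add_right {a b : ℕ} (A B C : Matrix (Fin a) (Fin b) ℝ) :
    frobInner A (B + C) = frobInner A B + frobInner A C := by
  simp only [frobInner, ← Finset.sum_add_distrib, Matrix.add_apply, mul_add]

lemma frobInner_smul_right {a b : ℕ} (t : ℝ) (A B : Matrix (Fin a) (Fin b) ℝ) :
    frobInner A (t • B) = t * frobInner A B := by
  simp only [frobInner, Finset.mul_sum, Matrix.smul_apply, smul_eq_mul, mul_left_comm]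

lemma eq_zero_of_vecSq_eq_zero {a : ℕ} {x : Fin a → ℝ} (h : vecSq x = 0) : x = 0 := by
  rw [vecSq_eq_dotProduct] at h
  exact dotProduct_self_eq_zero.1 h

lemma eq_zero_of_frobSq_eq_zero {a b : ℕ} {A : Matrix (Fin a) (Fin b) ℝ} (h : frobSq A = 0) :
    A = 0 := by
  have h1 := (Finset.sum_eq_zero_iff_of_nonneg fun i _ => vecSq_nonneg (A i)).1 h
  funext i
  exact eq_zero_of_vecSq_eq_zero (h1 i (Finset.mem_univ i))

lemma dotProduct_sq_le {a : ℕ} (x y : Fin a → ℝ) : (x ⬝ᵥ y) ^ 2 ≤ vecSq x * vecSq y :=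
  Finset.sum_mul_sq_le_sq_mul_sq _ _ _

lemma vecSq_mulVec_le {a b : ℕ} (A : Matrix (Fin a) (Fin b) ℝ) (x : Fin b → ℝ) :
    vecSq (A *ᵥ x) ≤ frobSq A * vecSq x := by
  rw [frobSq_eq_sum_vecSq, Finset.sum_mul]
  exact Finset.sum_le_sum fun i _ => dotProduct_sq_le (A i) x

lemma vecSq_add_add_le {a : ℕ} (x y z : Fin a → ℝ) :
    vecSq (x + y + z) ≤ 3 * (vecSq x + vecSq y + vecSq z) := by
  simp only [vecSq, ← Finset.sum_add_distrib, Finset.mul_sum]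
  refine Finset.sum_le_sum fun i _ => ?_
  simp only [Pi.add_apply]
  nlinarith [sq_nonneg (x i - y i), sq_nonneg (y i - z i), sq_nonneg (x i - z i)]

lemma sq_entry_le_vecSq {a : ℕ} (x : Fin a → ℝ) (i : Fin a) : x i ^ 2 ≤ vecSq x :=
  Finset.single_le_sum (f := fun i => x i ^ 2) (fun _ _ => sq_nonneg _) (Finset.mem_univ i)

lemma sq_entry_le_frobSq {a b : ℕ} (A : Matrix (Fin a) (Fin b) ℝ) (i : Fin a) (j : Fin b) :
    A i j ^ 2 ≤ frobSq A :=
  (sq_entry_le_vecSq (A i) j).trans <|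
    Finset.single_le_sum (f := fun i => vecSq (A i)) (fun _ _ => vecSq_nonneg _)
      (Finset.mem_univ i)

/-- A quadratic polynomial without constant term that is nonnegative on `ℝ` has vanishing
linear coefficient. -/
lemma linear_coeff_eq_zero {b c : ℝ} (h : ∀ t : ℝ, 0 ≤ t * b + t ^ 2 * c) : b = 0 := by
  have hc : 0 ≤ c := by nlinarith [h 1, h (-1)]
  have h1 := h (-b / (c + 1))
  have h2 : -b / (c + 1) * b + (-b / (c + 1)) ^ 2 * c = -(b ^ 2 / (c + 1) ^ 2) := by
    field_simp
    ring
  rw [h2] at h1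
  have h3 : b ^ 2 / (c + 1) ^ 2 = 0 := le_antisymm (by linarith) (by positivity)
  have h4 : (c + 1) ^ 2 ≠ 0 := by positivity
  simpa [h4] using h3

/-- The second-order part of the iALS loss in the user factors. -/
def lossQuad {m n d : ℕ} (R : Matrix (Fin m) (Fin n) ℝ) (α₀ : ℝ) (lamU : Fin m → ℝ)
    (V : Matrix (Fin n) (Fin d) ℝ) (E : Matrix (Fin m) (Fin d) ℝ) : ℝ :=
  (1/2) * ∑ i, ∑ j, (R i j + α₀) * (E i ⬝ᵥ V j) ^ 2 + (1/2) * ∑ i, lamU i * vecSq (E i)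

lemma lossQuad_smul {m n d : ℕ} (R : Matrix (Fin m) (Fin n) ℝ) (α₀ : ℝ) (lamU : Fin m → ℝ)
    (V : Matrix (Fin n) (Fin d) ℝ) (E : Matrix (Fin m) (Fin d) ℝ) (t : ℝ) :
    lossQuad R α₀ lamU V (t • E) = t ^ 2 * lossQuad R α₀ lamU V E := by
  have h : ∀ i, (t • E) i = t • E i := fun _ => rfl
  simp only [lossQuad, h, vecSq_smul, smul_dotProduct, smul_eq_mul, mul_add, Finset.mul_sum]
  congr 1
  · exact Finset.sum_congr rfl fun i _ => Finset.sum_congr rfl fun j _ => by ring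
  · exact Finset.sum_congr rfl fun i _ => by ring

lemma iALSLoss_eq_sum {m n d : ℕ} (R : Matrix (Fin m) (Fin n) ℝ) (α₀ : ℝ)
    (lamU : Fin m → ℝ) (lamV : Fin n → ℝ)
    (V : Matrix (Fin n) (Fin d) ℝ) (U : Matrix (Fin m) (Fin d) ℝ) :
    iALSLoss R α₀ lamU lamV V U =
      (∑ i, ∑ j, ((1/2) * (R i j * (R i j - U i ⬝ᵥ V j)) ^ 2 + α₀ / 2 * (U i ⬝ᵥ V j) ^ 2))
        + (1/2) * ∑ i, lamU i * vecSq (U i) + (1/2) * ∑ j, lamV j * vecSq (V j) := by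
  have h : ∀ i j, (U * Vᵀ) i j = U i ⬝ᵥ V j := fun _ _ => rfl
  simp only [iALSLoss, frobSq, hprod, Matrix.of_apply, Matrix.sub_apply, h,
    Finset.sum_add_distrib, Finset.mul_sum]

lemma iALSLoss_transpose {m n d : ℕ} (R : Matrix (Fin m) (Fin n) ℝ) (α₀ : ℝ)
    (lamU : Fin m → ℝ) (lamV : Fin n → ℝ)
    (V : Matrix (Fin n) (Fin d) ℝ) (U : Matrix (Fin m) (Fin d) ℝ) :
    iALSLoss Rᵀ α₀ lamV lamU U V = iALSLoss R α₀ lamU lamV V U := by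
  rw [iALSLoss_eq_sum, iALSLoss_eq_sum, Finset.sum_comm, add_right_comm]
  simp only [Matrix.transpose_apply, dotProduct_comm]

lemma dotProduct_gradU_row {m n d : ℕ} (R : Matrix (Fin m) (Fin n) ℝ) (α₀ : ℝ)
    (lamU : Fin m → ℝ) (V : Matrix (Fin n) (Fin d) ℝ) (U : Matrix (Fin m) (Fin d) ℝ)
    (i : Fin m) (e : Fin d → ℝ) :
    e ⬝ᵥ gradU R α₀ lamU V U i =
      (∑ j, (R i j * (U i ⬝ᵥ V j) + α₀ * (U i ⬝ᵥ V j) - R i j) * (e ⬝ᵥ V j))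
        + lamU i * (e ⬝ᵥ U i) := by
  have h : e ⬝ᵥ (Vᵀ * V) *ᵥ U i = ∑ j, (U i ⬝ᵥ V j) * (e ⬝ᵥ V j) := by
    rw [← Matrix.mulVec_mulVec, Matrix.dotProduct_mulVec, Matrix.vecMul_transpose]
    exact Finset.sum_congr rfl fun j _ => by
      simp only [Matrix.mulVec, dotProduct_comm (V j)]
      ring
  change e ⬝ᵥ (((∑ j, R i j • vecMulVec (V j) (V j)) + α₀ • (Vᵀ * V)
      + (lamU i) • (1 : Matrix (Fin d) (Fin d) ℝ)) *ᵥ U i - ∑ j, R i j • V j) = _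
  simp only [Matrix.add_mulVec, Matrix.sum_mulVec, Matrix.smul_mulVec,
    Matrix.one_mulVec, Matrix.vecMulVec_mulVec, dotProduct_sub, dotProduct_add, dotProduct_sum,
    dotProduct_smul, smul_eq_mul, h, Finset.mul_sum, op_smul_eq_smul]
  rw [add_sub_right_comm, ← Finset.sum_add_distrib, ← Finset.sum_sub_distrib]
  congr 1
  exact Finset.sum_congr rfl fun j _ => by rw [dotProduct_comm (V j) (U i)]; ring

lemma iALSLoss_add_right {m n d : ℕ} (R : Matrix (Fin m) (Fin n) ℝ)
    (hR : ∀ i j, R i j = 0 ∨ R i j = 1) (α₀ : ℝ) (lamU : Fin m → ℝ) (lamV : Fin n → ℝ)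
    (V : Matrix (Fin n) (Fin d) ℝ) (U E : Matrix (Fin m) (Fin d) ℝ) :
    iALSLoss R α₀ lamU lamV V (U + E) =
      iALSLoss R α₀ lamU lamV V U + frobInner E (gradU R α₀ lamU V U)
        + lossQuad R α₀ lamU V E := by
  have h : ∀ i, (U + E) i = U i + E i := fun _ => rfl
  simp only [iALSLoss_eq_sum, frobInner_eq_sum_dotProduct, lossQuad, dotProduct_gradU_row, h,
    vecSq_add, add_dotProduct]
  have h1 : ∀ i j, (1/2) * (R i j * (R i j - (U i ⬝ᵥ V j + E i ⬝ᵥ V j))) ^ 2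
        + α₀ / 2 * (U i ⬝ᵥ V j + E i ⬝ᵥ V j) ^ 2
      = ((1/2) * (R i j * (R i j - U i ⬝ᵥ V j)) ^ 2 + α₀ / 2 * (U i ⬝ᵥ V j) ^ 2)
        + (R i j * (U i ⬝ᵥ V j) + α₀ * (U i ⬝ᵥ V j) - R i j) * (E i ⬝ᵥ V j)
        + (1/2) * ((R i j + α₀) * (E i ⬝ᵥ V j) ^ 2) := by
    intro i j
    rcases hR i j with h | h <;> (rw [h]; ring)
  have h2 : ∀ i, lamU i * (vecSq (U i) + 2 * (E i ⬝ᵥ U i) + vecSq (E i))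
      = lamU i * vecSq (U i) + 2 * (lamU i * (E i ⬝ᵥ U i)) + lamU i * vecSq (E i) :=
    fun i => by ring
  simp only [h1, h2, Finset.sum_add_distrib, ← Finset.mul_sum]
  ring

lemma lossQuad_ge {m n d : ℕ} (R : Matrix (Fin m) (Fin n) ℝ)
    (hR : ∀ i j, R i j = 0 ∨ R i j = 1) {α₀ : ℝ} (hα : 0 < α₀) (lamU : Fin m → ℝ) {l : ℝ}
    (hl : ∀ i, l ≤ lamU i)
    (V : Matrix (Fin n) (Fin d) ℝ) (E : Matrix (Fin m) (Fin d) ℝ) :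
    l / 2 * frobSq E ≤ lossQuad R α₀ lamU V E := by
  have h1 : 0 ≤ ∑ i, ∑ j, (R i j + α₀) * (E i ⬝ᵥ V j) ^ 2 :=
    Finset.sum_nonneg fun i _ => Finset.sum_nonneg fun j _ => by
      rcases hR i j with h | h <;> rw [h] <;> positivity
  have h2 : l * frobSq E ≤ ∑ i, lamU i * vecSq (E i) := by
    rw [frobSq_eq_sum_vecSq, Finset.mul_sum]
    exact Finset.sum_le_sum fun i _ => mul_le_mul_of_nonneg_right (hl i) (vecSq_nonneg _)
  unfold lossQuad
  linarith

lemma lossQuad_le {m n d : ℕ} (R : Matrix (Fin m) (Fin n) ℝ)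
    (hR : ∀ i j, R i j = 0 ∨ R i j = 1) {α₀ : ℝ} (hα : 0 < α₀) (lamU : Fin m → ℝ) {l C : ℝ}
    (hl : ∀ i, lamU i ≤ l)
    (V : Matrix (Fin n) (Fin d) ℝ) (hV : frobSq V ≤ C) (E : Matrix (Fin m) (Fin d) ℝ) :
    lossQuad R α₀ lamU V E ≤ ((1 + α₀) * C + l) / 2 * frobSq E := by
  have h1 : ∑ i, ∑ j, (R i j + α₀) * (E i ⬝ᵥ V j) ^ 2 ≤ (1 + α₀) * C * frobSq E := by
    rw [frobSq_eq_sum_vecSq, Finset.mul_sum]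
    refine Finset.sum_le_sum fun i _ => ?_
    calc ∑ j, (R i j + α₀) * (E i ⬝ᵥ V j) ^ 2
        ≤ ∑ j, (1 + α₀) * (vecSq (V j) * vecSq (E i)) := by
          refine Finset.sum_le_sum fun j _ => mul_le_mul ?_ ?_ (sq_nonneg _) (by positivity)
          · rcases hR i j with h | h <;> linarith
          · rw [mul_comm]
            exact dotProduct_sq_le _ _
      _ = (1 + α₀) * (frobSq V * vecSq (E i)) := by
          rw [← Finset.mul_sum, ← Finset.sum_mul, frobSq_eq_sum_vecSq]
      _ ≤ (1 + α₀) * C * vecSq (E i) := by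
          rw [mul_assoc]
          have := vecSq_nonneg (E i)
          gcongr
  have h2 : ∑ i, lamU i * vecSq (E i) ≤ l * frobSq E := by
    rw [frobSq_eq_sum_vecSq, Finset.mul_sum]
    exact Finset.sum_le_sum fun i _ => mul_le_mul_of_nonneg_right (hl i) (vecSq_nonneg _)
  unfold lossQuad
  linarith

lemma gradV_eq {m n d : ℕ} (R : Matrix (Fin m) (Fin n) ℝ) (α₀ lamex : ℝ) (lamV : Fin n → ℝ)
    (V : Matrix (Fin n) (Fin d) ℝ) (U : Matrix (Fin m) (Fin d) ℝ) (s : Fin d → ℝ) :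
    gradV R α₀ lamex lamV V U s
      = gradU Rᵀ α₀ lamV U V + lamex • vecMulVec (V *ᵥ s) s := by
  ext j l
  have h : ((vecMulVec s s) *ᵥ V j) l = vecMulVec (V *ᵥ s) s j l := by
    rw [Matrix.vecMulVec_mulVec, vecMulVec_apply, dotProduct_comm]
    simp [Matrix.mulVec, mul_comm]
  simp only [gradV, gradU, Matrix.of_apply, Matrix.add_mulVec, Matrix.add_apply,
    Matrix.smul_mulVec, Pi.add_apply, Pi.sub_apply, Pi.smul_apply, Matrix.smul_apply, h,
    Matrix.transpose_apply]
  ring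

lemma frobInner_vecMulVec {a b : ℕ} (E : Matrix (Fin a) (Fin b) ℝ) (x : Fin a → ℝ)
    (y : Fin b → ℝ) : frobInner E (vecMulVec x y) = (E *ᵥ y) ⬝ᵥ x := by
  simp only [frobInner, vecMulVec_apply, dotProduct, Matrix.mulVec, Finset.sum_mul]
  exact Finset.sum_congr rfl fun i _ => Finset.sum_congr rfl fun j _ => by ring

lemma augL_add_V {m n d : ℕ} (R : Matrix (Fin m) (Fin n) ℝ)
    (hR : ∀ i j, R i j = 0 ∨ R i j = 1) (α₀ lamex : ℝ) (lamU : Fin m → ℝ) (lamV : Fin n → ℝ)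
    (ρ : ℝ) (V E : Matrix (Fin n) (Fin d) ℝ) (U : Matrix (Fin m) (Fin d) ℝ) (s w : Fin d → ℝ) :
    augL R α₀ lamex lamU lamV ρ (V + E) U s w =
      augL R α₀ lamex lamU lamV ρ V U s w + frobInner E (gradV R α₀ lamex lamV V U s)
        + (lossQuad Rᵀ α₀ lamV U E + lamex / 2 * vecSq (E *ᵥ s)) := by
  have hR' : ∀ i j, Rᵀ i j = 0 ∨ Rᵀ i j = 1 := fun i j => hR j i
  simp only [augL, gFun, ← iALSLoss_transpose R, gradV_eq, iALSLoss_add_right Rᵀ hR',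
    Matrix.add_mulVec, vecSq_add (V *ᵥ s), frobInner_add_right, frobInner_smul_right,
    frobInner_vecMulVec]
  ring

lemma augL_add_U {m n d : ℕ} (R : Matrix (Fin m) (Fin n) ℝ)
    (hR : ∀ i j, R i j = 0 ∨ R i j = 1) (α₀ lamex : ℝ) (lamU : Fin m → ℝ) (lamV : Fin n → ℝ)
    (ρ : ℝ) (V : Matrix (Fin n) (Fin d) ℝ) (U E : Matrix (Fin m) (Fin d) ℝ) (s w : Fin d → ℝ) :
    augL R α₀ lamex lamU lamV ρ V (U + E) s w =
      augL R α₀ lamex lamU lamV ρ V U s w + frobInner E (gradU R α₀ lamU V U)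
        + lossQuad R α₀ lamU V E
        + ρ / 2 * vecSq (avgRow (U + E) - s + w) - ρ / 2 * vecSq (avgRow U - s + w) := by
  simp only [augL, gFun, iALSLoss_add_right R hR]
  ring

lemma augL_add_s {m n d : ℕ} (R : Matrix (Fin m) (Fin n) ℝ) (α₀ lamex : ℝ)
    (lamU : Fin m → ℝ) (lamV : Fin n → ℝ) (ρ : ℝ) (V : Matrix (Fin n) (Fin d) ℝ)
    (U : Matrix (Fin m) (Fin d) ℝ) (s e w : Fin d → ℝ) :
    augL R α₀ lamex lamU lamV ρ V U (s + e) w =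
      augL R α₀ lamex lamU lamV ρ V U s w + e ⬝ᵥ gradSL lamex ρ V U s w
        + (lamex / 2 * vecSq (V *ᵥ e) + ρ / 2 * vecSq e) := by
  have h1 : avgRow U - (s + e) + w = (avgRow U - s + w) + -e := by abel
  have h2 : e ⬝ᵥ (Vᵀ * V) *ᵥ s = (V *ᵥ e) ⬝ᵥ (V *ᵥ s) := by
    rw [← Matrix.mulVec_mulVec, Matrix.dotProduct_mulVec, Matrix.vecMul_transpose]
  simp only [augL, gFun, gradSL, gradS, h1, vecSq_add (avgRow U - s + w), vecSq_neg,
    Matrix.mulVec_add, vecSq_add (V *ᵥ s), dotProduct_sub, dotProduct_smul, smul_eq_mul,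
    neg_dotProduct, h2]
  ring

lemma augL_update_w {m n d : ℕ} (R : Matrix (Fin m) (Fin n) ℝ) (α₀ lamex : ℝ)
    (lamU : Fin m → ℝ) (lamV : Fin n → ℝ) (ρ : ℝ) (V : Matrix (Fin n) (Fin d) ℝ)
    (U : Matrix (Fin m) (Fin d) ℝ) (s w w' : Fin d → ℝ) (h : w' = w + avgRow U - s) :
    augL R α₀ lamex lamU lamV ρ V U s w' =
      augL R α₀ lamex lamU lamV ρ V U s w + ρ * vecSq (w' - w) := by
  have h1 : avgRow U - s = w' - w := by rw [h]; abel
  simp only [augL, h1, vecSq, Pi.add_apply, Pi.sub_apply, sub_add_cancel]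
  have h2 : ∑ i, (w' i - w i + w' i) ^ 2
      = 2 * ∑ i, (w' i - w i) ^ 2 + 2 * ∑ i, w' i ^ 2 - ∑ i, w i ^ 2 := by
    simp only [Finset.mul_sum, ← Finset.sum_add_distrib, ← Finset.sum_sub_distrib]
    exact Finset.sum_congr rfl fun i _ => by ring
  rw [h2]
  ring

lemma avgRow_add {m d : ℕ} (U E : Matrix (Fin m) (Fin d) ℝ) :
    avgRow (U + E) = avgRow U + avgRow E := by
  funext l
  simp only [avgRow, Matrix.add_apply, Finset.sum_add_distrib, mul_add, Pi.add_apply]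

lemma avgRow_smul {m d : ℕ} (t : ℝ) (E : Matrix (Fin m) (Fin d) ℝ) :
    avgRow (t • E) = t • avgRow E := by
  funext l
  simp only [avgRow, Matrix.smul_apply, ← Finset.mul_sum, smul_eq_mul, Pi.smul_apply]
  ring

lemma frobInner_const_row {m d : ℕ} (E : Matrix (Fin m) (Fin d) ℝ) (x : Fin d → ℝ) (c : ℝ) :
    frobInner E (Matrix.of fun _ => (c / (m : ℝ)) • x) = c * (avgRow E ⬝ᵥ x) := by
  simp only [frobInner, Matrix.of_apply, Pi.smul_apply, smul_eq_mul, dotProduct, avgRow,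
    Finset.mul_sum, Finset.sum_mul]
  rw [Finset.sum_comm]
  exact Finset.sum_congr rfl fun i _ => Finset.sum_congr rfl fun j _ => by ring

lemma gradV_eq_zero_of_min {m n d : ℕ} (R : Matrix (Fin m) (Fin n) ℝ)
    (hR : ∀ i j, R i j = 0 ∨ R i j = 1) (α₀ lamex : ℝ) (lamU : Fin m → ℝ) (lamV : Fin n → ℝ)
    (ρ : ℝ) (V : Matrix (Fin n) (Fin d) ℝ) (U : Matrix (Fin m) (Fin d) ℝ) (s w : Fin d → ℝ)
    (hmin : ∀ V', augL R α₀ lamex lamU lamV ρ V U s w ≤ augL R α₀ lamex lamU lamV ρ V' U s w) :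
    gradV R α₀ lamex lamV V U s = 0 := by
  set G := gradV R α₀ lamex lamV V U s with hG
  refine eq_zero_of_frobSq_eq_zero (linear_coeff_eq_zero
    (c := lossQuad Rᵀ α₀ lamV U G + lamex / 2 * vecSq (G *ᵥ s)) fun t => ?_)
  have h := hmin (V + t • G)
  rw [augL_add_V R hR, ← hG, frobInner_smul_left, frobInner_self, lossQuad_smul,
    Matrix.smul_mulVec, vecSq_smul] at h
  linarith

lemma gradSL_eq_zero_of_min {m n d : ℕ} (R : Matrix (Fin m) (Fin n) ℝ) (α₀ lamex : ℝ)
    (lamU : Fin m → ℝ) (lamV : Fin n → ℝ)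
    (ρ : ℝ) (V : Matrix (Fin n) (Fin d) ℝ) (U : Matrix (Fin m) (Fin d) ℝ) (s w : Fin d → ℝ)
    (hmin : ∀ s', augL R α₀ lamex lamU lamV ρ V U s w ≤ augL R α₀ lamex lamU lamV ρ V U s' w) :
    gradSL lamex ρ V U s w = 0 := by
  set g := gradSL lamex ρ V U s w with hg
  refine eq_zero_of_vecSq_eq_zero (linear_coeff_eq_zero
    (c := lamex / 2 * vecSq (V *ᵥ g) + ρ / 2 * vecSq g) fun t => ?_)
  have h := hmin (s + t • g)
  rw [augL_add_s, ← hg, smul_dotProduct, ← vecSq_eq_dotProduct, Matrix.mulVec_smul,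
    vecSq_smul, vecSq_smul, smul_eq_mul] at h
  linarith

/-- First-order optimality of a proximal linearized step with penalty on the average row. -/
lemma proxStep_optimality {m d : ℕ} {γ ρ : ℝ} (hγ : 0 < γ) (G U U' : Matrix (Fin m) (Fin d) ℝ)
    (c : Fin d → ℝ)
    (hmin : ∀ X : Matrix (Fin m) (Fin d) ℝ,
      frobInner (U' - U) G + (1/(2*γ)) * frobSq (U' - U) + (ρ/2) * vecSq (avgRow U' + c)
        ≤ frobInner (X - U) G + (1/(2*γ)) * frobSq (X - U) + (ρ/2) * vecSq (avgRow X + c)) :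
    G + (1/γ) • (U' - U) + (Matrix.of fun _ => (ρ / (m : ℝ)) • (avgRow U' + c)) = 0 := by
  set H := G + (1/γ) • (U' - U) + (Matrix.of fun _ => (ρ / (m : ℝ)) • (avgRow U' + c)) with hH
  refine eq_zero_of_frobSq_eq_zero (linear_coeff_eq_zero
    (c := (1/(2*γ)) * frobSq H + (ρ/2) * vecSq (avgRow H)) fun t => ?_)
  have h := hmin (U' + t • H)
  have h1 : U' + t • H - U = (U' - U) + t • H := by abel
  have h2 : avgRow (U' + t • H) + c = (avgRow U' + c) + t • avgRow H := by
    rw [avgRow_add, avgRow_smul]; abel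
  have h3 : frobSq H = frobInner H G + (1/γ) * frobInner H (U' - U)
      + ρ * (avgRow H ⬝ᵥ (avgRow U' + c)) := by
    rw [← frobInner_const_row, ← frobInner_smul_right, ← frobInner_add_right,
      ← frobInner_add_right, ← hH, frobInner_self]
  rw [h1, h2, frobInner_add_left, frobInner_smul_left, frobSq_add, frobSq_smul,
    frobInner_smul_left, vecSq_add (avgRow U' + c), vecSq_smul, smul_dotProduct, smul_eq_mul] at h
  have h4 : (1/γ) = 2 * (1/(2*γ)) := by field_simp
  rw [h4] at h3
  nth_rewrite 1 [h3]
  linarith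

lemma tendsto_zero_of_sq_le {f g : ℕ → ℝ} (hfg : ∀ k, f k ^ 2 ≤ g k)
    (hg : Tendsto g atTop (𝓝 0)) : Tendsto f atTop (𝓝 0) := by
  have h : Tendsto (fun k => f k ^ 2) atTop (𝓝 0) :=
    squeeze_zero (fun _ => sq_nonneg _) hfg hg
  have h2 := h.sqrt
  simp only [Real.sqrt_sq_eq_abs, Real.sqrt_zero] at h2
  exact (tendsto_zero_iff_abs_tendsto_zero f).2 h2

lemma tendsto_vecNorm_zero {a : ℕ} {x : ℕ → Fin a → ℝ}
    (h : ∀ i, Tendsto (fun k => x k i) atTop (𝓝 0)) :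
    Tendsto (fun k => vecNorm (x k)) atTop (𝓝 0) := by
  have h1 : Tendsto (fun k => vecSq (x k)) atTop (𝓝 (∑ _i : Fin a, (0 : ℝ) ^ 2)) :=
    tendsto_finsetSum _ fun i _ => (h i).pow 2
  simpa [vecNorm] using h1.sqrt

lemma tendsto_frobNorm_zero {a b : ℕ} {A : ℕ → Matrix (Fin a) (Fin b) ℝ}
    (h : ∀ i j, Tendsto (fun k => A k i j) atTop (𝓝 0)) :
    Tendsto (fun k => frobNorm (A k)) atTop (𝓝 0) := by
  have h1 : Tendsto (fun k => frobSq (A k)) atTop (𝓝 (∑ _i : Fin a, ∑ _j : Fin b, (0 : ℝ) ^ 2)) :=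
    tendsto_finsetSum _ fun i _ => tendsto_finsetSum _ fun j _ => (h i j).pow 2
  simpa [frobNorm] using h1.sqrt

/-- A continuous function on a proper space maps asymptotically equal bounded sequences to
asymptotically equal sequences. -/
lemma tendsto_sub_of_continuous {X : Type*} [PseudoMetricSpace X] [ProperSpace X] {f : X → ℝ}
    (hf : Continuous f) {x y : ℕ → X} (hx : Bornology.IsBounded (Set.range x))
    (hy : Bornology.IsBounded (Set.range y))
    (hxy : Tendsto (fun k => dist (x k) (y k)) atTop (𝓝 0)) :
    Tendsto (fun k => f (x k) - f (y k)) atTop (𝓝 0) := by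
  have hK : IsCompact (closure (Set.range x ∪ Set.range y)) := (hx.union hy).isCompact_closure
  have hu := Metric.uniformContinuousOn_iff.1 (hK.uniformContinuousOn_of_continuous hf.continuousOn)
  rw [Metric.tendsto_atTop]
  intro ε hε
  obtain ⟨δ, hδ, h⟩ := hu ε hε
  obtain ⟨N, hN⟩ := Metric.tendsto_atTop.1 hxy δ hδ
  refine ⟨N, fun k hk => ?_⟩
  have h1 := hN k hk
  rw [Real.dist_0_eq_abs, abs_of_nonneg dist_nonneg] at h1
  have h2 := h (x k) (subset_closure (Or.inl ⟨k, rfl⟩)) (y k)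
    (subset_closure (Or.inr ⟨k, rfl⟩)) h1
  rwa [Real.dist_eq, sub_zero, ← Real.dist_eq]

lemma isBounded_range_of_vecSq_le {a : ℕ} {x : ℕ → Fin a → ℝ} {C : ℝ}
    (h : ∀ k, vecSq (x k) ≤ C) : Bornology.IsBounded (Set.range x) := by
  refine isBounded_iff_forall_norm_le.2 ⟨√C, ?_⟩
  rintro _ ⟨k, rfl⟩
  exact (pi_norm_le_iff_of_nonneg (Real.sqrt_nonneg _)).2 fun i =>
    Real.abs_le_sqrt ((sq_entry_le_vecSq _ i).trans (h k))

lemma isBounded_range_of_frobSq_le {a b : ℕ} {A : ℕ → Fin a → Fin b → ℝ} {C : ℝ}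
    (h : ∀ k, frobSq (A k) ≤ C) : Bornology.IsBounded (Set.range A) := by
  refine isBounded_iff_forall_norm_le.2 ⟨√C, ?_⟩
  rintro _ ⟨k, rfl⟩
  exact (pi_norm_le_iff_of_nonneg (Real.sqrt_nonneg _)).2 fun i =>
    (pi_norm_le_iff_of_nonneg (Real.sqrt_nonneg _)).2 fun j =>
      Real.abs_le_sqrt ((sq_entry_le_frobSq _ i j).trans (h k))

lemma tendsto_dist_of_vecSq {a : ℕ} {x y : ℕ → Fin a → ℝ}
    (h : Tendsto (fun k => vecSq (x k - y k)) atTop (𝓝 0)) :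
    Tendsto (fun k => dist (x k) (y k)) atTop (𝓝 0) := by
  simp only [dist_eq_norm]
  refine tendsto_zero_iff_norm_tendsto_zero.1 (tendsto_pi_nhds.2 fun i => ?_)
  exact tendsto_zero_of_sq_le (fun k => sq_entry_le_vecSq _ i) h

lemma tendsto_dist_of_frobSq {a b : ℕ} {A B : ℕ → Fin a → Fin b → ℝ}
    (h : Tendsto (fun k => frobSq (A k - B k)) atTop (𝓝 0)) :
    Tendsto (fun k => dist (A k) (B k)) atTop (𝓝 0) := by
  simp only [dist_eq_norm]
  refine tendsto_zero_iff_norm_tendsto_zero.1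
    (tendsto_pi_nhds.2 fun i => tendsto_pi_nhds.2 fun j => ?_)
  exact tendsto_zero_of_sq_le (fun k => sq_entry_le_frobSq _ i j) h

lemma tendsto_dist_prod {X Y : Type*} [PseudoMetricSpace X] [PseudoMetricSpace Y]
    {x x' : ℕ → X} {y y' : ℕ → Y} (hx : Tendsto (fun k => dist (x k) (x' k)) atTop (𝓝 0))
    (hy : Tendsto (fun k => dist (y k) (y' k)) atTop (𝓝 0)) :
    Tendsto (fun k => dist (x k, y k) (x' k, y' k)) atTop (𝓝 0) := by
  simpa [Prod.dist_eq] using hx.max hy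

lemma isBounded_range_prodMk {X Y : Type*} [PseudoMetricSpace X] [PseudoMetricSpace Y]
    {x : ℕ → X} {y : ℕ → Y} (hx : Bornology.IsBounded (Set.range x))
    (hy : Bornology.IsBounded (Set.range y)) :
    Bornology.IsBounded (Set.range fun k => (x k, y k)) :=
  (hx.prod hy).subset (by rintro _ ⟨k, rfl⟩; exact ⟨⟨k, rfl⟩, ⟨k, rfl⟩⟩)

lemma tendsto_zero_of_decrease {a c : ℕ → ℝ} {B : ℝ} (hB : ∀ k, B ≤ a k) (hc : ∀ k, 0 ≤ c k)
    (h : ∀ k, a (k + 1) + c k ≤ a k) : Tendsto c atTop (𝓝 0) := by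
  have hanti : Antitone a := antitone_nat_of_succ_le fun k => by linarith [h k, hc k]
  have hlim := tendsto_atTop_ciInf hanti ⟨B, by rintro _ ⟨k, rfl⟩; exact hB k⟩
  have hdiff := hlim.sub ((tendsto_add_atTop_iff_nat 1).2 hlim)
  rw [sub_self] at hdiff
  exact squeeze_zero hc (fun k => by linarith [h k]) hdiff

lemma continuous_gradV_entry {m n d : ℕ} (R : Matrix (Fin m) (Fin n) ℝ) (α₀ lamex : ℝ)
    (lamV : Fin n → ℝ) (j : Fin n) (l : Fin d) :
    Continuous fun p : (Fin n → Fin d → ℝ) × (Fin m → Fin d → ℝ) × (Fin d → ℝ) =>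
      gradV R α₀ lamex lamV p.1 p.2.1 p.2.2 j l := by
  simp only [gradV, Matrix.of_apply, Pi.sub_apply, Matrix.mulVec, dotProduct, Matrix.add_apply,
    Matrix.sum_apply, Matrix.smul_apply, vecMulVec_apply,
    Finset.sum_apply, Pi.smul_apply, smul_eq_mul]
  fun_prop

lemma continuous_gradU_entry {m n d : ℕ} (R : Matrix (Fin m) (Fin n) ℝ) (α₀ : ℝ)
    (lamU : Fin m → ℝ) (i : Fin m) (l : Fin d) :
    Continuous fun p : (Fin n → Fin d → ℝ) × (Fin m → Fin d → ℝ) =>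
      gradU R α₀ lamU p.1 p.2 i l := by
  simp only [gradU, Matrix.of_apply, Pi.sub_apply, Matrix.mulVec, dotProduct, Matrix.add_apply,
    Matrix.sum_apply, Matrix.smul_apply, vecMulVec_apply,
    Finset.sum_apply, Pi.smul_apply, smul_eq_mul]
  fun_prop

/-- The gradient `s ↦ VᵀV s` changes by at most a weighted sum of the changes in `V` and `s`. -/
lemma vecSq_gradS_sub_le {n d : ℕ} (lamex CV Cs : ℝ) (hCV : 0 ≤ CV)
    (V V' : Matrix (Fin n) (Fin d) ℝ) (s s' : Fin d → ℝ)
    (hV : frobSq V ≤ CV) (hV' : frobSq V' ≤ CV) (hs : vecSq s ≤ Cs) :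
    vecSq (gradS lamex V' s' - gradS lamex V s)
      ≤ 3 * lamex ^ 2 * (CV ^ 2 * vecSq (s' - s) + 2 * CV * Cs * frobSq (V' - V)) := by
  have h : gradS lamex V' s' - gradS lamex V s
      = lamex • (V'ᵀ *ᵥ (V' *ᵥ (s' - s)) + V'ᵀ *ᵥ ((V' - V) *ᵥ s) + (V' - V)ᵀ *ᵥ (V *ᵥ s)) := by
    simp only [gradS, ← Matrix.mulVec_mulVec, Matrix.mulVec_sub, Matrix.sub_mulVec,
      Matrix.transpose_sub, ← smul_sub]
    congr 1
    abel
  have hΔ := frobSq_nonneg (V' - V)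
  have h0 := frobSq_nonneg V
  have h0' := frobSq_nonneg V'
  have hss := vecSq_nonneg s
  have hsd := vecSq_nonneg (s' - s)
  have h1 : vecSq (V'ᵀ *ᵥ (V' *ᵥ (s' - s))) ≤ CV ^ 2 * vecSq (s' - s) :=
    calc _ ≤ frobSq V' * (frobSq V' * vecSq (s' - s)) := by
            refine (vecSq_mulVec_le _ _).trans ?_
            rw [frobSq_transpose]
            exact mul_le_mul_of_nonneg_left (vecSq_mulVec_le _ _) h0'
      _ ≤ CV * (CV * vecSq (s' - s)) := by gcongr
      _ = _ := by ring
  have h2 : vecSq (V'ᵀ *ᵥ ((V' - V) *ᵥ s)) ≤ CV * Cs * frobSq (V' - V) :=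
    calc _ ≤ frobSq V' * (frobSq (V' - V) * vecSq s) := by
            refine (vecSq_mulVec_le _ _).trans ?_
            rw [frobSq_transpose]
            exact mul_le_mul_of_nonneg_left (vecSq_mulVec_le _ _) h0'
      _ ≤ CV * (frobSq (V' - V) * Cs) := by gcongr
      _ = _ := by ring
  have h3 : vecSq ((V' - V)ᵀ *ᵥ (V *ᵥ s)) ≤ CV * Cs * frobSq (V' - V) :=
    calc _ ≤ frobSq (V' - V) * (frobSq V * vecSq s) := by
            refine (vecSq_mulVec_le _ _).trans ?_
            rw [frobSq_transpose]
            exact mul_le_mul_of_nonneg_left (vecSq_mulVec_le _ _) hΔ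
      _ ≤ frobSq (V' - V) * (CV * Cs) := by gcongr
      _ = _ := by ring
  rw [h, vecSq_smul]
  calc _ ≤ lamex ^ 2 * (3 * (CV ^ 2 * vecSq (s' - s) + CV * Cs * frobSq (V' - V)
            + CV * Cs * frobSq (V' - V))) := by
          gcongr
          exact (vecSq_add_add_le _ _ _).trans (by linarith)
    _ = _ := by ring

lemma vecSq_gradS_le {n d : ℕ} (lamex CV Cs : ℝ) (hCV : 0 ≤ CV)
    (V : Matrix (Fin n) (Fin d) ℝ) (s : Fin d → ℝ) (hV : frobSq V ≤ CV) (hs : vecSq s ≤ Cs) :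
    vecSq (gradS lamex V s) ≤ lamex ^ 2 * (CV ^ 2 * Cs) := by
  have h0 := frobSq_nonneg V
  have hss := vecSq_nonneg s
  rw [gradS, vecSq_smul, ← Matrix.mulVec_mulVec]
  gcongr
  calc _ ≤ frobSq V * (frobSq V * vecSq s) := by
          refine (vecSq_mulVec_le _ _).trans ?_
          rw [frobSq_transpose]
          exact mul_le_mul_of_nonneg_left (vecSq_mulVec_le _ _) h0
    _ ≤ CV * (CV * Cs) := by gcongr
    _ = _ := by ring

lemma augL_ge {m n d : ℕ} (R : Matrix (Fin m) (Fin n) ℝ) {α₀ lamex ρ : ℝ} (hα : 0 < α₀)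
    (hlamex : 0 < lamex) (hρ : 0 < ρ) (lamU : Fin m → ℝ) (lamV : Fin n → ℝ)
    (hlamU : ∀ i, 0 < lamU i) (hlamV : ∀ j, 0 < lamV j)
    (V : Matrix (Fin n) (Fin d) ℝ) (U : Matrix (Fin m) (Fin d) ℝ) (s w : Fin d → ℝ) :
    -(ρ / 2 * vecSq w) ≤ augL R α₀ lamex lamU lamV ρ V U s w := by
  have h1 : 0 ≤ ∑ i, lamU i * vecSq (U i) :=
    Finset.sum_nonneg fun i _ => mul_nonneg (hlamU i).le (vecSq_nonneg _)
  have h2 : 0 ≤ ∑ j, lamV j * vecSq (V j) :=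
    Finset.sum_nonneg fun j _ => mul_nonneg (hlamV j).le (vecSq_nonneg _)
  have h3 := frobSq_nonneg (hprod R (R - U * Vᵀ))
  have h4 := mul_nonneg hα.le (frobSq_nonneg (U * Vᵀ))
  have h5 := mul_nonneg hlamex.le (vecSq_nonneg (V *ᵥ s))
  have h6 := mul_nonneg hρ.le (vecSq_nonneg (avgRow U - s + w))
  unfold augL gFun iALSLoss
  linarith

/-- Sufficient decrease of the augmented Lagrangian in the `V`-step. -/
lemma augL_V_step {m n d : ℕ} (R : Matrix (Fin m) (Fin n) ℝ)
    (hR : ∀ i j, R i j = 0 ∨ R i j = 1) {α₀ lamex : ℝ} (hα : 0 < α₀) (hlamex : 0 < lamex)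
    (lamU : Fin m → ℝ) (lamV : Fin n → ℝ) {l : ℝ} (hl : ∀ j, l ≤ lamV j)
    (ρ : ℝ) (V V' : Matrix (Fin n) (Fin d) ℝ) (U : Matrix (Fin m) (Fin d) ℝ) (s w : Fin d → ℝ)
    (hmin : ∀ X, augL R α₀ lamex lamU lamV ρ V' U s w ≤ augL R α₀ lamex lamU lamV ρ X U s w) :
    augL R α₀ lamex lamU lamV ρ V' U s w + l / 2 * frobSq (V' - V)
      ≤ augL R α₀ lamex lamU lamV ρ V U s w := by
  have h := augL_add_V R hR α₀ lamex lamU lamV ρ V' (V - V') U s w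
  rw [add_sub_cancel, gradV_eq_zero_of_min R hR α₀ lamex lamU lamV ρ V' U s w hmin] at h
  have h0 : frobInner (V - V') 0 = 0 := by simp [frobInner]
  have h1 := lossQuad_ge Rᵀ (fun i j => hR j i) hα lamV hl U (V - V')
  have h2 := mul_nonneg hlamex.le (vecSq_nonneg ((V - V') *ᵥ s))
  rw [← frobSq_neg, neg_sub] at h1
  linarith

/-- Sufficient decrease of the augmented Lagrangian in the linearized `U`-step. -/
lemma augL_U_step {m n d : ℕ} (R : Matrix (Fin m) (Fin n) ℝ)
    (hR : ∀ i j, R i j = 0 ∨ R i j = 1) {α₀ : ℝ} (hα : 0 < α₀) (lamex : ℝ)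
    (lamU : Fin m → ℝ) (lamV : Fin n → ℝ) {l C γ : ℝ} (hl : ∀ i, lamU i ≤ l)
    (hγ : (1 + α₀) * C + l + 1 ≤ 1 / γ)
    (ρ : ℝ) (V : Matrix (Fin n) (Fin d) ℝ) (hV : frobSq V ≤ C) (U U' : Matrix (Fin m) (Fin d) ℝ)
    (s w : Fin d → ℝ)
    (hmin : ∀ X : Matrix (Fin m) (Fin d) ℝ,
      frobInner (U' - U) (gradU R α₀ lamU V U) + (1/(2*γ)) * frobSq (U' - U)
          + (ρ/2) * vecSq (avgRow U' - s + w)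
        ≤ frobInner (X - U) (gradU R α₀ lamU V U) + (1/(2*γ)) * frobSq (X - U)
          + (ρ/2) * vecSq (avgRow X - s + w)) :
    augL R α₀ lamex lamU lamV ρ V U' s w + 1 / 2 * frobSq (U' - U)
      ≤ augL R α₀ lamex lamU lamV ρ V U s w := by
  have h := augL_add_U R hR α₀ lamex lamU lamV ρ V U (U' - U) s w
  rw [add_sub_cancel] at h
  have h1 := lossQuad_le R hR hα lamU hl V hV (U' - U)
  have h2 := hmin U
  have h0 : frobInner (U - U) (gradU R α₀ lamU V U) = 0 := by simp [frobInner]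
  have h0' : frobSq (U - U) = 0 := by simp [frobSq]
  rw [h0, h0'] at h2
  have h3 := mul_le_mul_of_nonneg_right hγ (frobSq_nonneg (U' - U))
  have h4 : 1 / (2 * γ) = 1 / γ / 2 := by rw [div_div, mul_comm]
  rw [h4] at h2
  linarith

/-- Sufficient decrease of the augmented Lagrangian in the `s`-step. -/
lemma augL_s_step {m n d : ℕ} (R : Matrix (Fin m) (Fin n) ℝ) (α₀ : ℝ) {lamex : ℝ}
    (hlamex : 0 < lamex) (lamU : Fin m → ℝ) (lamV : Fin n → ℝ) (ρ : ℝ)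
    (V : Matrix (Fin n) (Fin d) ℝ) (U : Matrix (Fin m) (Fin d) ℝ) (s s' w : Fin d → ℝ)
    (hmin : ∀ x, augL R α₀ lamex lamU lamV ρ V U s' w ≤ augL R α₀ lamex lamU lamV ρ V U x w) :
    augL R α₀ lamex lamU lamV ρ V U s' w + ρ / 2 * vecSq (s' - s)
      ≤ augL R α₀ lamex lamU lamV ρ V U s w := by
  have h := augL_add_s R α₀ lamex lamU lamV ρ V U s' (s - s') w
  rw [add_sub_cancel, gradSL_eq_zero_of_min R α₀ lamex lamU lamV ρ V U s' w hmin,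
    dotProduct_zero] at h
  have h2 := mul_nonneg hlamex.le (vecSq_nonneg (V *ᵥ (s - s')))
  rw [← vecSq_neg (s' - s), neg_sub]
  linarith

/-- the gradients of the augmented Lagrangian along the exADMM iterates
converge to zero. -/
theorem exADMM_gradient_convergence {m n d : ℕ} (hm : 1 ≤ m) (hn : 1 ≤ n) (hd : 1 ≤ d)
    (R : Matrix (Fin m) (Fin n) ℝ) (hR : ∀ i j, R i j = 0 ∨ R i j = 1)
    (α₀ lamex ρ γ : ℝ) (hα : 0 < α₀) (hlamex : 0 < lamex) (hρ0 : 0 < ρ) (hγ0 : 0 < γ)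
    (lamU : Fin m → ℝ) (lamV : Fin n → ℝ)
    (hlamU : ∀ i, 0 < lamU i) (hlamV : ∀ j, 0 < lamV j)
    (lamUbar lamVlow : ℝ)
    (hUbar : IsGreatest (Set.range lamU) lamUbar)
    (hVlow : IsLeast (Set.range lamV) lamVlow)
    (Vs : ℕ → Matrix (Fin n) (Fin d) ℝ) (Us : ℕ → Matrix (Fin m) (Fin d) ℝ)
    (ss ws : ℕ → Fin d → ℝ)
    (CV CU Cs : ℝ) (hCV : 0 < CV) (hCU : 0 < CU) (hCs : 0 < Cs)
    (hVb : ∀ k, frobSq (Vs k) ≤ CV) (hUb : ∀ k, frobSq (Us k) ≤ CU)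
    (hsb : ∀ k, vecSq (ss k) ≤ Cs)
    (hρ : ρ ≥ max (24 * lamex ^ 2 * CV * Cs / lamVlow)
        (1/2 + Real.sqrt (1/4 + 6 * lamex ^ 2 * CV ^ 2)))
    (hγ : γ ≤ 1 / (Real.sqrt m * ((1 + α₀) * CV + lamUbar) + 1))
    (hVmin : ∀ k, ∀ V' : Matrix (Fin n) (Fin d) ℝ,
      augL R α₀ lamex lamU lamV ρ (Vs (k+1)) (Us k) (ss k) (ws k)
        ≤ augL R α₀ lamex lamU lamV ρ V' (Us k) (ss k) (ws k))
    (hUmin : ∀ k, ∀ U' : Matrix (Fin m) (Fin d) ℝ,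
      frobInner (Us (k+1) - Us k) (gradU R α₀ lamU (Vs (k+1)) (Us k))
          + (1/(2*γ)) * frobSq (Us (k+1) - Us k)
          + (ρ/2) * vecSq (avgRow (Us (k+1)) - ss k + ws k)
        ≤ frobInner (U' - Us k) (gradU R α₀ lamU (Vs (k+1)) (Us k))
          + (1/(2*γ)) * frobSq (U' - Us k)
          + (ρ/2) * vecSq (avgRow U' - ss k + ws k))
    (hsmin : ∀ k, ∀ s' : Fin d → ℝ,
      augL R α₀ lamex lamU lamV ρ (Vs (k+1)) (Us (k+1)) (ss (k+1)) (ws k)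
        ≤ augL R α₀ lamex lamU lamV ρ (Vs (k+1)) (Us (k+1)) s' (ws k))
    (hw : ∀ k, ws (k+1) = ws k + avgRow (Us (k+1)) - ss (k+1)) :
    Filter.Tendsto (fun k => frobNorm (gradV R α₀ lamex lamV (Vs k) (Us k) (ss k)))
        Filter.atTop (nhds 0)
    ∧ Filter.Tendsto (fun k => frobNorm (gradUL R α₀ lamU ρ (Vs k) (Us k) (ss k) (ws k)))
        Filter.atTop (nhds 0)
    ∧ Filter.Tendsto (fun k => vecNorm (gradSL lamex ρ (Vs k) (Us k) (ss k) (ws k)))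
        Filter.atTop (nhds 0)
    ∧ Filter.Tendsto (fun k => vecNorm (gradWL ρ (Us k) (ss k)))
        Filter.atTop (nhds 0) := by
  have hlU : ∀ i, lamU i ≤ lamUbar := fun i => hUbar.2 ⟨i, rfl⟩
  have hlV : ∀ j, lamVlow ≤ lamV j := fun j => hVlow.2 ⟨j, rfl⟩
  have hlU0 : 0 < lamUbar := by obtain ⟨i, hi⟩ := hUbar.1; exact hi ▸ hlamU i
  have hlV0 : 0 < lamVlow := by obtain ⟨j, hj⟩ := hVlow.1; exact hj ▸ hlamV j
  have hγ' : (1 + α₀) * CV + lamUbar + 1 ≤ 1 / γ := by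
    have hm1 : (1 : ℝ) ≤ √m := Real.one_le_sqrt.2 (by exact_mod_cast hm)
    have hL : 0 < (1 + α₀) * CV + lamUbar := by positivity
    rw [le_one_div hγ0 (by positivity)] at hγ
    nlinarith
  have hρ1 : 6 * lamex ^ 2 * CV * Cs ≤ lamVlow / 4 * ρ := by
    have h := (le_max_left _ _).trans hρ
    rw [div_le_iff₀ hlV0] at h
    linarith
  have hρ2 : 3 * lamex ^ 2 * CV ^ 2 ≤ (ρ - 1) / 2 * ρ := by
    have h := Real.sqrt_le_iff.1
      (show √(1/4 + 6 * lamex ^ 2 * CV ^ 2) ≤ ρ - 1/2 by linarith [(le_max_right _ _).trans hρ])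
    nlinarith [h.2]
  have hs_opt : ∀ k, ρ • ws (k+1) = gradS lamex (Vs (k+1)) (ss (k+1)) := fun k => by
    have h := gradSL_eq_zero_of_min R α₀ lamex lamU lamV ρ _ _ _ _ (hsmin k)
    rw [gradSL, sub_eq_zero] at h
    rw [h, hw k]
    congr 1
    abel
  have hw_diff : ∀ k, ρ * vecSq (ws (k+2) - ws (k+1))
      ≤ (ρ - 1) / 2 * vecSq (ss (k+2) - ss (k+1))
        + lamVlow / 4 * frobSq (Vs (k+2) - Vs (k+1)) := fun k => by
    have h := vecSq_gradS_sub_le lamex CV Cs hCV.le (Vs (k+1)) (Vs (k+2)) (ss (k+1)) (ss (k+2))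
      (hVb _) (hVb _) (hsb _)
    rw [← hs_opt k, ← hs_opt (k+1), ← smul_sub, vecSq_smul] at h
    have h1 := mul_le_mul_of_nonneg_right hρ1 (frobSq_nonneg (Vs (k+2) - Vs (k+1)))
    have h2 := mul_le_mul_of_nonneg_right hρ2 (vecSq_nonneg (ss (k+2) - ss (k+1)))
    refine le_of_mul_le_mul_left ?_ hρ0
    linarith
  set Φ : ℕ → ℝ := fun k =>
    augL R α₀ lamex lamU lamV ρ (Vs (k+1)) (Us (k+1)) (ss (k+1)) (ws (k+1)) with hΦ
  set δ : ℕ → ℝ := fun k => lamVlow / 4 * frobSq (Vs (k+2) - Vs (k+1))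
    + 1 / 2 * frobSq (Us (k+2) - Us (k+1)) + 1 / 2 * vecSq (ss (k+2) - ss (k+1)) with hδ
  have hdec : ∀ k, Φ (k+1) + δ k ≤ Φ k := fun k => by
    have h1 := augL_V_step R hR hα hlamex lamU lamV hlV ρ (Vs (k+1)) (Vs (k+2)) _ _ _
      (hVmin (k+1))
    have h2 := augL_U_step R hR hα lamex lamU lamV hlU hγ' ρ (Vs (k+2)) (hVb _) (Us (k+1))
      (Us (k+2)) _ _ (hUmin (k+1))
    have h3 := augL_s_step R α₀ hlamex lamU lamV ρ _ _ (ss (k+1)) (ss (k+2)) _ (hsmin (k+1))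
    have h4 := augL_update_w R α₀ lamex lamU lamV ρ (Vs (k+2)) _ _ _ _ (hw (k+1))
    have h5 := hw_diff k
    simp only [hΦ, hδ]
    linarith
  have hwb : ∀ k, vecSq (ws (k+1)) ≤ lamex ^ 2 * (CV ^ 2 * Cs) / ρ ^ 2 := fun k => by
    have h := vecSq_gradS_le lamex CV Cs hCV.le (Vs (k+1)) (ss (k+1)) (hVb _) (hsb _)
    rw [← hs_opt k, vecSq_smul] at h
    rw [le_div_iff₀ (by positivity)]
    linarith
  have hΦb : ∀ k, -(ρ / 2 * (lamex ^ 2 * (CV ^ 2 * Cs) / ρ ^ 2)) ≤ Φ k := fun k => by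
    refine le_trans (neg_le_neg ?_)
      (augL_ge R hα hlamex hρ0 lamU lamV hlamU hlamV (Vs (k+1)) (Us (k+1)) (ss (k+1)) (ws (k+1)))
    exact mul_le_mul_of_nonneg_left (hwb k) (by positivity)
  have hδV : ∀ k, 0 ≤ lamVlow / 4 * frobSq (Vs (k+2) - Vs (k+1)) := fun k =>
    mul_nonneg (by positivity) (frobSq_nonneg _)
  have hδU : ∀ k, 0 ≤ 1 / 2 * frobSq (Us (k+2) - Us (k+1)) := fun k =>
    mul_nonneg (by positivity) (frobSq_nonneg _)
  have hδs : ∀ k, 0 ≤ 1 / 2 * vecSq (ss (k+2) - ss (k+1)) := fun k =>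
    mul_nonneg (by positivity) (vecSq_nonneg _)
  have hδk : ∀ k, δ k = lamVlow / 4 * frobSq (Vs (k+2) - Vs (k+1))
      + 1 / 2 * frobSq (Us (k+2) - Us (k+1)) + 1 / 2 * vecSq (ss (k+2) - ss (k+1)) :=
    fun _ => rfl
  have hδ0 : Tendsto δ atTop (𝓝 0) :=
    tendsto_zero_of_decrease hΦb (fun k => by linarith [hδk k, hδV k, hδU k, hδs k]) hdec
  have hVlim : Tendsto (fun k => frobSq (Vs (k+2) - Vs (k+1))) atTop (𝓝 0) := by
    refine squeeze_zero (fun _ => frobSq_nonneg _) (fun k => ?_)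
      (by simpa using hδ0.const_mul (4 / lamVlow))
    rw [div_mul_eq_mul_div, le_div_iff₀ hlV0]
    linarith [hδk k, hδU k, hδs k]
  have hUlim : Tendsto (fun k => frobSq (Us (k+2) - Us (k+1))) atTop (𝓝 0) :=
    squeeze_zero (g := fun k => 2 * δ k) (fun _ => frobSq_nonneg _)
      (fun k => by linarith [hδk k, hδV k, hδs k]) (by simpa using hδ0.const_mul 2)
  have hslim : Tendsto (fun k => vecSq (ss (k+2) - ss (k+1))) atTop (𝓝 0) :=
    squeeze_zero (g := fun k => 2 * δ k) (fun _ => vecSq_nonneg _)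
      (fun k => by linarith [hδk k, hδV k, hδU k]) (by simpa using hδ0.const_mul 2)
  have hwlim : Tendsto (fun k => vecSq (ws (k+2) - ws (k+1))) atTop (𝓝 0) := by
    refine squeeze_zero (fun _ => vecSq_nonneg _) (fun k => ?_)
      (by simpa using ((hslim.const_mul ((ρ - 1) / 2)).add
        (hVlim.const_mul (lamVlow / 4))).div_const ρ)
    rw [le_div_iff₀ hρ0]
    linarith [hw_diff k]
  have hwentry : ∀ l, Tendsto (fun k => ws (k+2) l - ws (k+1) l) atTop (𝓝 0) := fun l =>
    tendsto_zero_of_sq_le (fun k => sq_entry_le_vecSq (ws (k+2) - ws (k+1)) l) hwlim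
  have hsentry : ∀ l, Tendsto (fun k => ss (k+2) l - ss (k+1) l) atTop (𝓝 0) := fun l =>
    tendsto_zero_of_sq_le (fun k => sq_entry_le_vecSq (ss (k+2) - ss (k+1)) l) hslim
  have hUentry : ∀ i l, Tendsto (fun k => Us (k+2) i l - Us (k+1) i l) atTop (𝓝 0) := fun i l =>
    tendsto_zero_of_sq_le (fun k => sq_entry_le_frobSq (Us (k+2) - Us (k+1)) i l) hUlim
  have hgradW : ∀ k, gradWL ρ (Us (k+1)) (ss (k+1)) = ρ • (ws (k+1) - ws k) := fun k => by
    rw [gradWL, hw k]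
    congr 1
    abel
  have hWlim : ∀ l, Tendsto (fun k => gradWL ρ (Us (k+2)) (ss (k+2)) l) atTop (𝓝 0) := fun l => by
    simpa [hgradW] using (hwentry l).const_mul ρ
  refine ⟨(tendsto_add_atTop_iff_nat 2).1 (tendsto_frobNorm_zero fun j l => ?_),
    (tendsto_add_atTop_iff_nat 2).1 (tendsto_frobNorm_zero fun i l => ?_),
    (tendsto_add_atTop_iff_nat 2).1 (tendsto_vecNorm_zero fun l => ?_),
    (tendsto_add_atTop_iff_nat 2).1 (tendsto_vecNorm_zero hWlim)⟩
  · have hV2 := isBounded_range_of_frobSq_le (A := fun k => Vs (k+2)) fun k => hVb _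
    have h := tendsto_sub_of_continuous (continuous_gradV_entry R α₀ lamex lamV j l)
      (isBounded_range_prodMk hV2 (isBounded_range_prodMk
        (isBounded_range_of_frobSq_le (A := fun k => Us (k+2)) fun k => hUb _)
        (isBounded_range_of_vecSq_le (x := fun k => ss (k+2)) fun k => hsb _)))
      (isBounded_range_prodMk hV2 (isBounded_range_prodMk
        (isBounded_range_of_frobSq_le (A := fun k => Us (k+1)) fun k => hUb _)
        (isBounded_range_of_vecSq_le (x := fun k => ss (k+1)) fun k => hsb _)))
      (tendsto_dist_prod (tendsto_const_nhds.congr fun _ => (dist_self _).symm)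
        (tendsto_dist_prod (tendsto_dist_of_frobSq hUlim) (tendsto_dist_of_vecSq hslim)))
    refine h.congr fun k => ?_
    have h0 := gradV_eq_zero_of_min R hR α₀ lamex lamU lamV ρ _ _ _ _ (hVmin (k+1))
    have h1 : gradV R α₀ lamex lamV (Vs (k+2)) (Us (k+1)) (ss (k+1)) j l = 0 :=
      congrFun (congrFun h0 j) l
    simp only [h1, sub_zero]
  · have hV2 := isBounded_range_of_frobSq_le (A := fun k => Vs (k+2)) fun k => hVb _
    have h := tendsto_sub_of_continuous (continuous_gradU_entry R α₀ lamU i l)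
      (isBounded_range_prodMk hV2
        (isBounded_range_of_frobSq_le (A := fun k => Us (k+2)) fun k => hUb _))
      (isBounded_range_prodMk hV2
        (isBounded_range_of_frobSq_le (A := fun k => Us (k+1)) fun k => hUb _))
      (tendsto_dist_prod (tendsto_const_nhds.congr fun _ => (dist_self _).symm)
        (tendsto_dist_of_frobSq hUlim))
    have h' := (h.sub ((hUentry i l).const_mul (1 / γ))).add
      (((hwentry l).sub (hsentry l)).const_mul (ρ / m))
    simp only [mul_zero, sub_zero, add_zero] at h'
    refine h'.congr fun k => ?_
    have h0 := proxStep_optimality (ρ := ρ) hγ0 (gradU R α₀ lamU (Vs (k+2)) (Us (k+1)))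
      (Us (k+1)) (Us (k+2)) (-ss (k+1) + ws (k+1))
      (by simpa only [← add_assoc, ← sub_eq_add_neg] using hUmin (k+1))
    have h1 : gradU R α₀ lamU (Vs (k+2)) (Us (k+1)) i l
        + 1 / γ * (Us (k+2) i l - Us (k+1) i l)
        + ρ / m * (avgRow (Us (k+2)) l + (-ss (k+1) l + ws (k+1) l)) = 0 :=
      congrFun (congrFun h0 i) l
    have h2 : gradUL R α₀ lamU ρ (Vs (k+2)) (Us (k+2)) (ss (k+2)) (ws (k+2)) i l
        = gradU R α₀ lamU (Vs (k+2)) (Us (k+2)) i l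
          + ρ / m * (avgRow (Us (k+2)) l - ss (k+2) l + ws (k+2) l) := rfl
    rw [h2]
    linear_combination -h1
  · refine (by simpa using (hWlim l).neg :
      Tendsto (fun k => -gradWL ρ (Us (k+2)) (ss (k+2)) l) atTop (𝓝 0)).congr fun k => ?_
    have h : gradSL lamex ρ (Vs (k+2)) (Us (k+2)) (ss (k+2)) (ws (k+2))
        = -gradWL ρ (Us (k+2)) (ss (k+2)) := by
      rw [gradSL, gradWL, ← hs_opt (k+1), smul_add]
      abel
    rw [h, Pi.neg_apply]
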